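/- arXiv:1911.02758 — 6 statements merged into one kernel-verified Lean document; each statement's English description precedes it below -/
import Mathlib

section
/- Let X be a set, T an infinite-branching well-founded tree (every non-leaf node τ of T has all sequences τ⌢i, i < ω, as one-step extensions in T), 𝒜 a collection of subsets of X closed under countable unions and finite intersections which has the σ-reduction property, and {U_τ} a monotone T-family of sets from 𝒜. Then there is a reduced T-family {V_τ} of sets from 𝒜 such that V_τ ⊆ U_τ for all τ ∈ T, ⋃_{τ∈T} V_τ = ⋃_{τ∈T} U_τ, for every non-leaf node τ ∈ T the union of the sets V_{τ⌢i} (over τ⌢i ∈ T) equals the union of the sets V_τ ∩ U_{τ⌢i} (over τ⌢i ∈ T), and the component Ṽ_τ of {V_τ} at τ is contained in the component Ũ_τ of {U_τ} at τ, for every τ ∈ T. -/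
open Set

namespace IFHpaper

noncomputable section

/-- The first uncountable ordinal. -/
def w1 : Ordinal.{0} := (Cardinal.aleph 1).ord

/-- A tree: a nonempty, prefix-closed set of finite sequences of naturals. -/
def IsTree (T : Set (List ℕ)) : Prop :=
  T.Nonempty ∧ ∀ σ τ : List ℕ, σ <+: τ → τ ∈ T → σ ∈ T

/-- A well-founded tree: a tree with no infinite path. -/
def IsWFTree (T : Set (List ℕ)) : Prop :=
  IsTree T ∧ ∀ x : ℕ → ℕ, ∃ n : ℕ, (List.range n).map x ∉ T

/-- The proper extensions of `τ` lying in `T`. -/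
def properExt (T : Set (List ℕ)) (τ : List ℕ) : Set (List ℕ) :=
  {τ' | τ' ∈ T ∧ τ <+: τ' ∧ τ ≠ τ'}

/-- The component of a `T`-family at node `τ`:  `U τ` minus the union of the sets
attached to proper extensions of `τ` in `T`. -/
def component {X : Type} (T : Set (List ℕ)) (U : List ℕ → Set X) (τ : List ℕ) : Set X :=
  U τ \ ⋃ τ' ∈ properExt T τ, U τ'

/-- A `T`-family is monotone if `U τ ⊇ U τ'` whenever `τ ⊑ τ'` in `T`. -/
def MonotoneFam {X : Type} (T : Set (List ℕ)) (U : List ℕ → Set X) : Prop :=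
  ∀ τ ∈ T, ∀ τ' ∈ T, τ <+: τ' → U τ' ⊆ U τ

/-- A reduced `T`-family: monotone, with disjoint sets at distinct one-step extensions. -/
def ReducedFam {X : Type} (T : Set (List ℕ)) (U : List ℕ → Set X) : Prop :=
  MonotoneFam T U ∧
    ∀ (τ : List ℕ) (i j : ℕ), τ ++ [i] ∈ T → τ ++ [j] ∈ T → i ≠ j →
      U (τ ++ [i]) ∩ U (τ ++ [j]) = ∅

/-- An infinite-branching tree: every non-leaf node has all its one-step extensions in `T`. -/
def InfBranching (T : Set (List ℕ)) : Prop :=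
  ∀ τ ∈ T, (∃ τ' ∈ T, τ <+: τ' ∧ τ ≠ τ') → ∀ i : ℕ, τ ++ [i] ∈ T

/-- The σ-reduction property for a collection of sets. -/
def SigmaReduction {X : Type} (𝒜 : Set (Set X)) : Prop :=
  ∀ C : ℕ → Set X, (∀ i, C i ∈ 𝒜) →
    ∃ C' : ℕ → Set X, (∀ i, C' i ∈ 𝒜) ∧ (∀ i, C' i ⊆ C i) ∧
      (∀ i j, i ≠ j → C' i ∩ C' j = ∅) ∧ (⋃ i, C' i) = ⋃ i, C i

/-- A (hierarchy) base in a set `X`: an `ω₁`-indexed family of collections of subsets of `X`,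
each closed under countable unions and finite intersections, and increasing in the
appropriate sense. -/
structure IsBase {X : Type} (L : Ordinal.{0} → Set (Set X)) : Prop where
  iUnion_mem : ∀ α < w1, ∀ f : ℕ → Set X, (∀ n, f n ∈ L α) → (⋃ n, f n) ∈ L α
  inter_mem : ∀ α < w1, ∀ A B : Set X, A ∈ L α → B ∈ L α → A ∩ B ∈ L α
  empty_mem : ∀ α < w1, (∅ : Set X) ∈ L α
  univ_mem : ∀ α < w1, (univ : Set X) ∈ L α
  mono : ∀ α β : Ordinal.{0}, α < β → β < w1 → ∀ A : Set X, A ∈ L α → A ∈ L β ∧ Aᶜ ∈ L β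

/-- The `β`-shift of a base: level `α` of the shift is level `β + α` of `L`. -/
def shiftL {X : Type} (L : Ordinal.{0} → Set (Set X)) (β : Ordinal.{0}) :
    Ordinal.{0} → Set (Set X) := fun α => L (β + α)

/-- The `V`-restriction of a base: level `α` consists of the sets `V ∩ S`, `S ∈ L α`. -/
def restrictL {X : Type} (L : Ordinal.{0} → Set (Set X)) (V : Set X) :
    Ordinal.{0} → Set (Set X) := fun α => {W | ∃ S ∈ L α, W = V ∩ S}

open Classical in
/-- The Borel hierarchy `Σ⁰_α(X)` (defined for `1 ≤ α`): `Σ⁰₁` is the open sets, `Σ⁰₂` the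
countable unions of differences of open sets, and for `α > 2`, `Σ⁰_α` consists of the
countable unions of complements of sets in lower levels `Σ⁰_β`, `1 ≤ β < α`. -/
def SigmaO (X : Type) [TopologicalSpace X] (α : Ordinal.{0}) : Set (Set X) :=
  if α = 1 then {U : Set X | IsOpen U}
  else if α = 2 then
    {A : Set X | ∃ U V : ℕ → Set X, (∀ n, IsOpen (U n)) ∧ (∀ n, IsOpen (V n)) ∧
      A = ⋃ n, U n \ V n}
  else
    {A : Set X | ∃ S : ℕ → Set X,
      (∀ n, ∃ β : Ordinal.{0}, ∃ _ : β < α, 1 ≤ β ∧ S n ∈ SigmaO X β) ∧ A = ⋃ n, (S n)ᶜ}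
termination_by α
decreasing_by assumption

/-- The Borel base of a topological space: level `α` is `Σ⁰_{1+α}(X)`. -/
def borelBase (X : Type) [TopologicalSpace X] : Ordinal.{0} → Set (Set X) :=
  fun α => SigmaO X (1 + α)

/-- The existential category quantifier `f[A]`:  the set of `y` such that `A ∩ f⁻¹(y)` is
non-meager in the subspace `f⁻¹(y)`. -/
def catIm {X Y : Type} [TopologicalSpace X] (f : X → Y) (A : Set X) : Set Y :=
  {y | ¬ IsMeagre ((Subtype.val : (f ⁻¹' {y} : Set X) → X) ⁻¹' A)}

/-- A space is zero-dimensional if it has a basis of clopen sets. -/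
def ZeroDim (X : Type) [TopologicalSpace X] : Prop :=
  ∀ (x : X) (U : Set X), IsOpen U → x ∈ U → ∃ V : Set X, IsClopen V ∧ x ∈ V ∧ V ⊆ U

/-- Countable ordinals. -/
abbrev CtbOrd : Type 1 := {α : Ordinal.{0} // α < w1}

/-- Terms over a quasiorder `Q`: constants `q ∈ Q`, unary `s_α`, and `ω`-ary `F_q`, `F_α`
(`α` a countable ordinal). -/
inductive Term (Q : Type) : Type 1 where
  | const : Q → Term Q
  | s : CtbOrd → Term Q → Term Q
  | Fc : Q → (ℕ → Term Q) → Term Q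
  | Fo : CtbOrd → (ℕ → Term Q) → Term Q

/-- The relation `⊴` on terms. -/
inductive TLE {Q : Type} [Preorder Q] : Term Q → Term Q → Prop where
  | const_const {q r : Q} : q ≤ r → TLE (.const q) (.const r)
  | const_s {q : Q} {a : CtbOrd} {u : Term Q} :
      TLE (.const q) u → TLE (.const q) (.s a u)
  | const_Fc_left {q r : Q} {vs : ℕ → Term Q} :
      TLE (.const q) (.const r) → TLE (.const q) (.Fc r vs)
  | const_Fc_right {q r : Q} {vs : ℕ → Term Q} (i : ℕ) :
      TLE (.const q) (vs i) → TLE (.const q) (.Fc r vs)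
  | const_Fo {q : Q} {b : CtbOrd} {vs : ℕ → Term Q} (i : ℕ) :
      TLE (.const q) (vs i) → TLE (.const q) (.Fo b vs)
  | s_const {a : CtbOrd} {u : Term Q} {r : Q} :
      TLE u (.const r) → TLE (.s a u) (.const r)
  | s_s_lt {a b : CtbOrd} {u v : Term Q} :
      a.1 < b.1 → TLE u (.s b v) → TLE (.s a u) (.s b v)
  | s_s_eq {a : CtbOrd} {u v : Term Q} :
      TLE u v → TLE (.s a u) (.s a v)
  | s_s_gt {a b : CtbOrd} {u v : Term Q} :
      b.1 < a.1 → TLE (.s a u) v → TLE (.s a u) (.s b v)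
  | s_Fc_left {a : CtbOrd} {u : Term Q} {r : Q} {vs : ℕ → Term Q} :
      TLE (.s a u) (.const r) → TLE (.s a u) (.Fc r vs)
  | s_Fc_right {a : CtbOrd} {u : Term Q} {r : Q} {vs : ℕ → Term Q} (i : ℕ) :
      TLE (.s a u) (vs i) → TLE (.s a u) (.Fc r vs)
  | s_Fo_left {a : CtbOrd} {u : Term Q} {b : CtbOrd} {vs : ℕ → Term Q} :
      TLE (.s a u) (.s b (vs 0)) → TLE (.s a u) (.Fo b vs)
  | s_Fo_right {a : CtbOrd} {u : Term Q} {b : CtbOrd} {vs : ℕ → Term Q} (i : ℕ) :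
      TLE (.s a u) (vs (i + 1)) → TLE (.s a u) (.Fo b vs)
  | Fc_const {q : Q} {us : ℕ → Term Q} {r : Q} :
      TLE (.const q) (.const r) → (∀ i, TLE (us i) (.const r)) →
      TLE (.Fc q us) (.const r)
  | Fc_s {q : Q} {us : ℕ → Term Q} {b : CtbOrd} {v : Term Q} :
      TLE (.const q) (.s b v) → (∀ i, TLE (us i) (.s b v)) →
      TLE (.Fc q us) (.s b v)
  | Fc_Fc_left {q : Q} {us : ℕ → Term Q} {r : Q} {vs : ℕ → Term Q} :
      TLE (.const q) (.const r) → (∀ i, TLE (us i) (.Fc r vs)) →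
      TLE (.Fc q us) (.Fc r vs)
  | Fc_Fc_right {q : Q} {us : ℕ → Term Q} {r : Q} {vs : ℕ → Term Q} (i : ℕ) :
      TLE (.Fc q us) (vs i) → TLE (.Fc q us) (.Fc r vs)
  | Fc_Fo_left {q : Q} {us : ℕ → Term Q} {b : CtbOrd} {vs : ℕ → Term Q} :
      TLE (.const q) (.s b (vs 0)) → (∀ i, TLE (us i) (.Fo b vs)) →
      TLE (.Fc q us) (.Fo b vs)
  | Fc_Fo_right {q : Q} {us : ℕ → Term Q} {b : CtbOrd} {vs : ℕ → Term Q} (i : ℕ) :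
      TLE (.Fc q us) (vs (i + 1)) → TLE (.Fc q us) (.Fo b vs)
  | Fo_const {a : CtbOrd} {us : ℕ → Term Q} {r : Q} :
      TLE (.s a (us 0)) (.const r) → (∀ i, TLE (us (i + 1)) (.const r)) →
      TLE (.Fo a us) (.const r)
  | Fo_s {a : CtbOrd} {us : ℕ → Term Q} {b : CtbOrd} {v : Term Q} :
      TLE (.s a (us 0)) (.s b v) → (∀ i, TLE (us (i + 1)) (.s b v)) →
      TLE (.Fo a us) (.s b v)
  | Fo_Fc_left {a : CtbOrd} {us : ℕ → Term Q} {r : Q} {vs : ℕ → Term Q} :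
      TLE (.s a (us 0)) (.const r) → (∀ i, TLE (us (i + 1)) (.Fc r vs)) →
      TLE (.Fo a us) (.Fc r vs)
  | Fo_Fc_right {a : CtbOrd} {us : ℕ → Term Q} {r : Q} {vs : ℕ → Term Q} (i : ℕ) :
      TLE (.Fo a us) (vs i) → TLE (.Fo a us) (.Fc r vs)
  | Fo_Fo_left {a : CtbOrd} {us : ℕ → Term Q} {b : CtbOrd} {vs : ℕ → Term Q} :
      TLE (.s a (us 0)) (.s b (vs 0)) → (∀ i, TLE (us (i + 1)) (.Fo b vs)) →
      TLE (.Fo a us) (.Fo b vs)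
  | Fo_Fo_right {a : CtbOrd} {us : ℕ → Term Q} {b : CtbOrd} {vs : ℕ → Term Q} (i : ℕ) :
      TLE (.Fo a us) (vs (i + 1)) → TLE (.Fo a us) (.Fo b vs)

/-- `u`-families over a base `L`, on a domain (ambient set) `D ⊆ X`, defined by recursion
on the term `u` following the labeled tree `T(u)`:
* a `q`-family is trivial;
* an `s_α(u)`-family is a `u`-family over the `ω^α`-shift of the base;
* an `F_q(u₀,…)`-family consists of a monotone `T(u)`-family of level-`0` sets of the base
  restricted to the current domain (encoded via the child sets `U i ∈ 𝓛₀(D)` together with,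
  recursively, the `uᵢ`-families on the `U i`, which carry the deeper tree sets);
* an `F_α(u₀,…)`-family additionally carries the `s_α(u₀)`-family attached to the root,
  living on the component `D \ ⋃ᵢ U i` of the root. -/
inductive Fam {X Q : Type} : Term Q → (Ordinal.{0} → Set (Set X)) → Set X → Type 1 where
  | const (q : Q) (L : Ordinal.{0} → Set (Set X)) (D : Set X) : Fam (.const q) L D
  | s (a : CtbOrd) (u : Term Q) (L : Ordinal.{0} → Set (Set X)) (D : Set X) :
      Fam u (shiftL L (Ordinal.omega0 ^ a.1)) D → Fam (.s a u) L D
  | Fc (q : Q) (us : ℕ → Term Q) (L : Ordinal.{0} → Set (Set X)) (D : Set X)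
      (U : ℕ → Set X) (hU : ∀ i, U i ∈ restrictL L D 0)
      (fams : ∀ i, Fam (us i) L (U i)) : Fam (.Fc q us) L D
  | Fo (a : CtbOrd) (us : ℕ → Term Q) (L : Ordinal.{0} → Set (Set X)) (D : Set X)
      (U : ℕ → Set X) (hU : ∀ i, U i ∈ restrictL L D 0)
      (F0 : Fam (us 0) (shiftL L (Ordinal.omega0 ^ a.1)) (D \ ⋃ i, U i))
      (fams : ∀ i, Fam (us (i + 1)) L (U i)) : Fam (.Fo a us) L D

/-- The relation "the `u`-family `F` (on domain `D`) determines the `Q`-partition `A`". -/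
def Determines {X Q : Type} : (u : Term Q) → (L : Ordinal.{0} → Set (Set X)) → (D : Set X) →
    Fam u L D → (X → Q) → Prop
  | _, _, _, .const q _ D, A => ∀ x ∈ D, A x = q
  | _, _, _, .s a u L D F, A => Determines u (shiftL L (Ordinal.omega0 ^ a.1)) D F A
  | _, _, _, .Fc q us L D U _ fams, A =>
      (∀ x ∈ D \ ⋃ i, U i, A x = q) ∧ ∀ i, Determines (us i) L (U i) (fams i) A
  | _, _, _, .Fo a us L D U _ F0 fams, A =>
      Determines (us 0) (shiftL L (Ordinal.omega0 ^ a.1)) (D \ ⋃ i, U i) F0 A ∧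
        ∀ i, Determines (us (i + 1)) L (U i) (fams i) A

/-- A `u`-family is reduced if all monotone tree families occurring in it are reduced
(sets at distinct siblings are disjoint), recursively. -/
def FamReduced {X Q : Type} : (u : Term Q) → (L : Ordinal.{0} → Set (Set X)) → (D : Set X) →
    Fam u L D → Prop
  | _, _, _, .const _ _ _ => True
  | _, _, _, .s a u L D F => FamReduced u (shiftL L (Ordinal.omega0 ^ a.1)) D F
  | _, _, _, .Fc _ us L _ U _ fams =>
      (∀ i j, i ≠ j → U i ∩ U j = ∅) ∧ ∀ i, FamReduced (us i) L (U i) (fams i)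
  | _, _, _, .Fo a us L D U _ F0 fams =>
      (∀ i j, i ≠ j → U i ∩ U j = ∅) ∧
        FamReduced (us 0) (shiftL L (Ordinal.omega0 ^ a.1)) (D \ ⋃ i, U i) F0 ∧
        ∀ i, FamReduced (us (i + 1)) L (U i) (fams i)

/-- The level `𝓛(D,u)` of the infinitary fine hierarchy over the base `L` restricted to the
domain `D`: the `Q`-partitions determined by some `u`-family on `D`. -/
def levelOn {X : Type} (Q : Type) (L : Ordinal.{0} → Set (Set X)) (D : Set X) (u : Term Q) :
    Set (X → Q) :=
  {A | ∃ F : Fam u L D, Determines u L D F A}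

/-- The level `𝓛(X,u)` of the infinitary fine hierarchy over the base `L`. -/
def level {X : Type} (Q : Type) (L : Ordinal.{0} → Set (Set X)) (u : Term Q) : Set (X → Q) :=
  levelOn Q L Set.univ u

/-- `red-𝓛(X,u)`: the `Q`-partitions determined by some reduced `u`-family. -/
def levelRed {X : Type} (Q : Type) (L : Ordinal.{0} → Set (Set X)) (u : Term Q) :
    Set (X → Q) :=
  {A | ∃ F : Fam u L Set.univ, FamReduced u L Set.univ F ∧ Determines u L Set.univ F A}

/-- Wadge reducibility of `Q`-partitions of a space `X`. -/
def WadgeLe {X : Type} [TopologicalSpace X] {Q : Type} [Preorder Q] (A B : X → Q) : Prop :=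
  ∃ f : X → X, Continuous f ∧ ∀ x, A x ≤ B (f x)

/-- The downward Wadge closure `𝓛̂(X,u)` of the level `𝓛(X,u)`. -/
def levelHat {X : Type} [TopologicalSpace X] (Q : Type) [Preorder Q]
    (L : Ordinal.{0} → Set (Set X)) (u : Term Q) : Set (X → Q) :=
  {A | ∃ B ∈ level Q L u, WadgeLe A B}


/-- The family obtained from `U` by keeping the set at the root and applying, node by node, the
operation `R` to the traces of the sets at the children; nodes are written in reverse order. -/
def reductRev {X : Type} (R : (ℕ → Set X) → ℕ → Set X) (U : List ℕ → Set X) : List ℕ → Set X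
  | [] => U []
  | i :: l => R (fun j => reductRev R U l ∩ U (l.reverse ++ [j])) i

/-- The family `reductRev R U`, indexed by nodes in the usual order. -/
def reduct {X : Type} (R : (ℕ → Set X) → ℕ → Set X) (U : List ℕ → Set X) (τ : List ℕ) : Set X :=
  reductRev R U τ.reverse

theorem reduct_nil {X : Type} (R : (ℕ → Set X) → ℕ → Set X) (U : List ℕ → Set X) :
    reduct R U [] = U [] := rfl

theorem reduct_append_singleton {X : Type} (R : (ℕ → Set X) → ℕ → Set X) (U : List ℕ → Set X)
    (τ : List ℕ) (i : ℕ) :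
    reduct R U (τ ++ [i]) = R (fun j => reduct R U τ ∩ U (τ ++ [j])) i := by
  simp [reduct, reductRev]

theorem IsTree.nil_mem {T : Set (List ℕ)} (hT : IsTree T) : [] ∈ T := by
  obtain ⟨⟨τ, hτ⟩, h⟩ := hT
  exact h [] τ List.nil_prefix hτ

theorem IsTree.mem_of_append {T : Set (List ℕ)} (hT : IsTree T) {σ τ : List ℕ}
    (h : σ ++ τ ∈ T) : σ ∈ T :=
  hT.2 _ _ (List.prefix_append _ _) h

theorem InfBranching.sibling_mem {T : Set (List ℕ)} (hib : InfBranching T) (hT : IsTree T)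
    {τ : List ℕ} {i : ℕ} (h : τ ++ [i] ∈ T) (j : ℕ) : τ ++ [j] ∈ T :=
  hib τ (hT.mem_of_append h) ⟨_, h, List.prefix_append _ _, by simp⟩ j

/-- A family whose sets decrease along one-step extensions is monotone. -/
theorem monotoneFam_of_append_singleton {X : Type} {T : Set (List ℕ)} (hT : IsTree T)
    {V : List ℕ → Set X} (h : ∀ τ i, τ ++ [i] ∈ T → V (τ ++ [i]) ⊆ V τ) : MonotoneFam T V := by
  rintro τ _ _ hσ ⟨σ, rfl⟩
  induction σ using List.reverseRecOn with
  | nil => simp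
  | append_singleton σ i ih =>
    rw [← List.append_assoc] at hσ ⊢
    exact (h _ i hσ).trans (ih (hT.mem_of_append hσ))

/-- The union of a monotone family is the set at the root. -/
theorem MonotoneFam.biUnion_eq {X : Type} {T : Set (List ℕ)} (hT : IsTree T)
    {U : List ℕ → Set X} (h : MonotoneFam T U) : (⋃ τ ∈ T, U τ) = U [] :=
  Subset.antisymm (iUnion₂_subset fun τ hτ => h [] hT.nil_mem τ hτ List.nil_prefix)
    (subset_biUnion_of_mem (u := U) hT.nil_mem)

/-- Lemma "reduce": reducts of monotone `T`-families over an infinite-branching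
well-founded tree, for a collection with the σ-reduction property. -/
theorem statement2 {X : Type} (T : Set (List ℕ)) (hT : IsWFTree T) (hib : InfBranching T)
    (𝒜 : Set (Set X))
    (hcu : ∀ S : Set (Set X), S.Countable → S ⊆ 𝒜 → ⋃₀ S ∈ 𝒜)
    (hin : ∀ A B : Set X, A ∈ 𝒜 → B ∈ 𝒜 → A ∩ B ∈ 𝒜)
    (hred : SigmaReduction 𝒜)
    (U : List ℕ → Set X) (hmono : MonotoneFam T U) (hU : ∀ τ ∈ T, U τ ∈ 𝒜) :
    ∃ V : List ℕ → Set X,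
      (∀ τ ∈ T, V τ ∈ 𝒜) ∧ ReducedFam T V ∧ (∀ τ ∈ T, V τ ⊆ U τ) ∧
      (⋃ τ ∈ T, V τ) = (⋃ τ ∈ T, U τ) ∧
      (∀ τ ∈ T, (∃ τ' ∈ T, τ <+: τ' ∧ τ ≠ τ') →
        (⋃ i ∈ {i : ℕ | τ ++ [i] ∈ T}, V (τ ++ [i])) =
          ⋃ i ∈ {i : ℕ | τ ++ [i] ∈ T}, V τ ∩ U (τ ++ [i])) ∧
      ∀ τ ∈ T, component T V τ ⊆ component T U τ := by
  have htree := hT.1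
  choose! R hRmem hRsub hRdisj hRunion using hred
  set V := reduct R U with hV
  have hmem : ∀ τ ∈ T, V τ ∈ 𝒜 := by
    intro τ
    induction τ using List.reverseRecOn with
    | nil => exact hU []
    | append_singleton τ i ih =>
      intro h
      rw [hV, reduct_append_singleton]
      exact hRmem _ (fun j => hin _ _ (ih (htree.mem_of_append h))
        (hU _ (hib.sibling_mem htree h j))) i
  have htrace : ∀ τ i, τ ++ [i] ∈ T → ∀ j, V τ ∩ U (τ ++ [j]) ∈ 𝒜 := fun τ i h j =>
    hin _ _ (hmem τ (htree.mem_of_append h)) (hU _ (hib.sibling_mem htree h j))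
  have hsub : ∀ τ i, τ ++ [i] ∈ T → V (τ ++ [i]) ⊆ V τ ∩ U (τ ++ [i]) := by
    intro τ i h
    rw [hV, reduct_append_singleton]
    exact hRsub _ (htrace τ i h) i
  have hVmono : MonotoneFam T V :=
    monotoneFam_of_append_singleton htree fun τ i h => (hsub τ i h).trans inter_subset_left
  have hVU : ∀ τ ∈ T, V τ ⊆ U τ := by
    intro τ hτ
    induction τ using List.reverseRecOn with
    | nil => exact subset_rfl
    | append_singleton τ i => exact (hsub τ i hτ).trans inter_subset_right
  have hchildren : ∀ τ ∈ T, (∃ τ' ∈ T, τ <+: τ' ∧ τ ≠ τ') →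
      (⋃ i ∈ {i : ℕ | τ ++ [i] ∈ T}, V (τ ++ [i])) =
        ⋃ i ∈ {i : ℕ | τ ++ [i] ∈ T}, V τ ∩ U (τ ++ [i]) := by
    intro τ hτ hext
    have hall := hib τ hτ hext
    simp only [mem_ofPred_eq, hall, iUnion_true]
    rw [← hRunion _ (htrace τ 0 (hall 0))]
    simp only [hV, reduct_append_singleton]
  refine ⟨V, hmem, ⟨hVmono, ?_⟩, hVU, ?_, hchildren, ?_⟩
  · intro τ i j hi _ hij
    rw [hV, reduct_append_singleton, reduct_append_singleton]
    exact hRdisj _ (htrace τ i hi) i j hij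
  · rw [hVmono.biUnion_eq htree, hmono.biUnion_eq htree, hV, reduct_nil]
  · rintro τ hτ x ⟨hxV, hx⟩
    refine ⟨hVU τ hτ hxV, ?_⟩
    simp only [properExt, mem_ofPred_eq, mem_iUnion, not_exists] at hx ⊢
    rintro _ ⟨hτ', ⟨_ | ⟨i, σ⟩, rfl⟩, hne⟩ hxU
    · simp at hne
    · have hall := hib τ hτ ⟨_, hτ', ⟨_, rfl⟩, hne⟩
      have hxi : x ∈ U (τ ++ [i]) :=
        hmono _ (hall i) _ hτ' ⟨σ, by simp⟩ hxU
      have hxun : x ∈ ⋃ i ∈ {i : ℕ | τ ++ [i] ∈ T}, V (τ ++ [i]) := by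
        rw [hchildren τ hτ ⟨_, hτ', ⟨_, rfl⟩, hne⟩]
        exact mem_biUnion (hall i) ⟨hxV, hxi⟩
      obtain ⟨j, hj, hxj⟩ := mem_iUnion₂.1 hxun
      exact hx _ ⟨hj, List.prefix_append _ _, by simp⟩ hxj

end

end IFHpaper
end

section
/- Let X be a set, T a well-founded tree, and ρ ∈ T. Then there is exactly one reduced T-family {U_τ} of subsets of X whose component at ρ satisfies Ũ_ρ = X; it is given by U_τ = X for τ ⊑ ρ and U_τ = ∅ otherwise, and necessarily Ũ_τ = ∅ for all τ ∈ T with τ ≠ ρ. -/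
open Set

namespace IFHpaper

noncomputable section

/-- Two incomparable finite sequences branch off at a common node. -/
theorem exists_branching_of_not_prefix {α : Type*} :
    ∀ {σ τ : List α}, ¬ σ <+: τ → ¬ τ <+: σ →
      ∃ (υ : List α) (a b : α), a ≠ b ∧ υ ++ [a] <+: σ ∧ υ ++ [b] <+: τ
  | [], _, h, _ => absurd List.nil_prefix h
  | _ :: _, [], _, h => absurd List.nil_prefix h
  | a :: σ, b :: τ, h, h' => by
    by_cases hab : a = b
    · subst hab
      rw [List.prefix_cons_inj] at h h'
      obtain ⟨υ, c, d, hcd, hc, hd⟩ := exists_branching_of_not_prefix h h'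
      exact ⟨a :: υ, c, d, hcd, by simpa using hc, by simpa using hd⟩
    · exact ⟨[], a, b, hab, by simp, by simp⟩

/-- In a reduced family, the sets at incomparable nodes are disjoint. -/
theorem ReducedFam.disjoint_of_not_prefix {X : Type} {T : Set (List ℕ)} {V : List ℕ → Set X}
    (hT : IsTree T) (hV : ReducedFam T V) {σ τ : List ℕ} (hσ : σ ∈ T) (hτ : τ ∈ T)
    (h : ¬ σ <+: τ) (h' : ¬ τ <+: σ) : Disjoint (V σ) (V τ) := by
  obtain ⟨υ, i, j, hij, hi, hj⟩ := exists_branching_of_not_prefix h h'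
  have hiT := hT.2 _ _ hi hσ
  have hjT := hT.2 _ _ hj hτ
  exact (Set.disjoint_iff_inter_eq_empty.2 (hV.2 υ i j hiT hjT hij)).mono
    (hV.1 _ hiT _ hσ hi) (hV.1 _ hjT _ hτ hj)

/-- A reduced family whose component at `ρ` is everything is full at the prefixes of `ρ`. -/
theorem ReducedFam.eq_univ_of_prefix {X : Type} {T : Set (List ℕ)} {V : List ℕ → Set X}
    (hV : ReducedFam T V) {ρ τ : List ℕ} (hρ : ρ ∈ T) (hτ : τ ∈ T)
    (h : component T V ρ = Set.univ) (hτρ : τ <+: ρ) : V τ = Set.univ :=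
  Set.univ_subset_iff.1 (h ▸ Set.sdiff_subset.trans (hV.1 _ hτ _ hρ hτρ))

/-- A reduced family whose component at `ρ` is everything is empty off the prefixes of `ρ`. -/
theorem ReducedFam.eq_empty_of_not_prefix {X : Type} {T : Set (List ℕ)} {V : List ℕ → Set X}
    (hT : IsTree T) (hV : ReducedFam T V) {ρ τ : List ℕ} (hρ : ρ ∈ T) (hτ : τ ∈ T)
    (h : component T V ρ = Set.univ) (hτρ : ¬ τ <+: ρ) : V τ = ∅ := by
  by_cases hρτ : ρ <+: τ
  · refine Set.eq_empty_of_forall_notMem fun x hx => ?_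
    have hxc : x ∈ component T V ρ := h ▸ Set.mem_univ x
    exact hxc.2 (Set.mem_biUnion ⟨hτ, hρτ, fun e => hτρ (e ▸ List.prefix_rfl)⟩ hx)
  · have hd := hV.disjoint_of_not_prefix hT hτ hρ hτρ hρτ
    rwa [hV.eq_univ_of_prefix hρ hρ h List.prefix_rfl, Set.disjoint_univ] at hd

/-- Lemma "reduce3": there is exactly one reduced `T`-family whose component at `ρ` is
the whole set `X`, namely `U τ = X` for `τ ⊑ ρ` and `U τ = ∅` otherwise; its other
components are necessarily empty. -/
theorem statement3 {X : Type} (T : Set (List ℕ)) (hT : IsWFTree T)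
    (ρ : List ℕ) (hρ : ρ ∈ T) :
    ∃ U : List ℕ → Set X,
      ReducedFam T U ∧ component T U ρ = Set.univ ∧
      (∀ τ ∈ T, τ <+: ρ → U τ = Set.univ) ∧
      (∀ τ ∈ T, ¬ τ <+: ρ → U τ = ∅) ∧
      (∀ τ ∈ T, τ ≠ ρ → component T U τ = ∅) ∧
      (∀ V : List ℕ → Set X, ReducedFam T V → component T V ρ = Set.univ →
        ∀ τ ∈ T, V τ = U τ) := by
  refine ⟨fun τ => {_x | τ <+: ρ}, ⟨?_, ?_⟩, ?_, ?_, ?_, ?_, ?_⟩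
  · exact fun τ _ τ' _ h x hx => h.trans hx
  · refine fun τ i j _ _ hij => Set.eq_empty_of_forall_notMem fun x hx => hij ?_
    have h := (List.prefix_of_prefix_length_le hx.1 hx.2 (by simp)).eq_of_length (by simp)
    simpa using h
  · refine Set.eq_univ_of_forall fun x => ⟨List.prefix_rfl, fun hx => ?_⟩
    obtain ⟨τ, ⟨_, hρτ, hne⟩, hτρ⟩ := Set.mem_iUnion₂.1 hx
    exact hne (hρτ.eq_of_length (hρτ.length_le.antisymm (List.IsPrefix.length_le hτρ)))
  · exact fun τ _ h => Set.eq_univ_of_forall fun _ => h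
  · exact fun τ _ h => Set.eq_empty_of_forall_notMem fun _ hx => h hx
  · exact fun τ _ hne => Set.eq_empty_of_forall_notMem fun x hx =>
      hx.2 (Set.mem_biUnion (x := ρ) ⟨hρ, hx.1, hne⟩ List.prefix_rfl)
  · intro V hV h τ hτ
    by_cases hτρ : τ <+: ρ
    · simpa [hτρ] using hV.eq_univ_of_prefix hρ hτ h hτρ
    · simpa [hτρ] using hV.eq_empty_of_not_prefix hT.1 hρ hτ h hτρ

end

end IFHpaper
end

section
/- Let f : X → Y be a function between topological spaces, T a well-founded tree, and {U_τ}_{τ∈T} a T-family of subsets of X. Then {f[U_τ]}_{τ∈T} is a T-family of subsets of Y and, for every τ ∈ T, the component of the T-family {f[U_τ]} at τ is contained in f[Ũ_τ], where Ũ_τ is the component of {U_τ} at τ. -/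
open Set

namespace IFHpaper

noncomputable section

/-- Lemma "catim(2)", second part: the component of the family `{f[U_τ]}` at `τ` is
contained in `f[Ũ_τ]`. -/
theorem statement5 {X Y : Type} [TopologicalSpace X] [TopologicalSpace Y] (f : X → Y)
    (T : Set (List ℕ)) (hT : IsWFTree T) (U : List ℕ → Set X) :
    ∀ τ ∈ T, component T (fun σ => catIm f (U σ)) τ ⊆ catIm f (component T U τ) := by
  rintro τ - y ⟨hy, hn⟩ hm
  simp only [mem_iUnion, not_exists] at hn
  have hcount : (properExt T τ).Countable := to_countable _
  have hExt : IsMeagre (⋃ σ ∈ properExt T τ,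
      (Subtype.val : (f ⁻¹' {y} : Set X) → X) ⁻¹' U σ) :=
    isMeagre_biUnion hcount fun σ hσ => not_not.mp (hn σ hσ)
  refine hy ((hm.union hExt).mono fun x hx => ?_)
  by_cases h : (x : X) ∈ ⋃ σ ∈ properExt T τ, U σ
  · exact Or.inr (by simpa using h)
  · exact Or.inl ⟨hx, h⟩

end

end IFHpaper
end

section
/- Let f : X → Y be a function between topological spaces and α < ω₁ be such that f⁻¹(U) ∈ Σ⁰_{1+α}(X) for every open set U ⊆ Y. Then for every β < ω₁ and every A ∈ Σ⁰_{1+β}(Y), f⁻¹(A) ∈ Σ⁰_{1+(α+β)}(X). In particular, if f is continuous then f⁻¹(A) ∈ Σ⁰_{1+β}(X) for every A ∈ Σ⁰_{1+β}(Y). -/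
open Set

namespace IFHpaper

noncomputable section

section Hierarchy

variable {X : Type} [TopologicalSpace X]

theorem mem_SigmaO_one {A : Set X} : A ∈ SigmaO X 1 ↔ IsOpen A := by
  rw [SigmaO]
  simp

theorem mem_SigmaO_two {A : Set X} :
    A ∈ SigmaO X 2 ↔ ∃ U V : ℕ → Set X, (∀ n, IsOpen (U n)) ∧ (∀ n, IsOpen (V n)) ∧
      A = ⋃ n, U n \ V n := by
  rw [SigmaO]
  simp

theorem mem_SigmaO_of_two_lt {γ : Ordinal.{0}} (hγ : 2 < γ) {A : Set X} :
    A ∈ SigmaO X γ ↔ ∃ S : ℕ → Set X,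
      (∀ n, ∃ β < γ, 1 ≤ β ∧ S n ∈ SigmaO X β) ∧ A = ⋃ n, (S n)ᶜ := by
  have h1 : γ ≠ 1 := (one_lt_two.trans hγ).ne'
  rw [SigmaO, if_neg h1, if_neg hγ.ne']
  simp only [exists_prop, mem_ofPred_eq]

theorem eq_one_or_eq_two_or_two_lt {γ : Ordinal.{0}} (hγ : 1 ≤ γ) : γ = 1 ∨ γ = 2 ∨ 2 < γ := by
  rcases hγ.eq_or_lt with h | h
  · exact Or.inl h.symm
  · have h2 : 2 ≤ γ := by
      rw [← one_add_one_eq_two]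
      exact Order.add_one_le_of_lt h
    exact Or.inr (h2.eq_or_lt.imp Eq.symm id)

theorem iUnion_mem_SigmaO {γ : Ordinal.{0}} (hγ : 1 ≤ γ) {A : ℕ → Set X}
    (hA : ∀ n, A n ∈ SigmaO X γ) : (⋃ n, A n) ∈ SigmaO X γ := by
  rcases eq_one_or_eq_two_or_two_lt hγ with rfl | rfl | h
  · simp only [mem_SigmaO_one] at *
    exact isOpen_iUnion hA
  · simp only [mem_SigmaO_two] at hA
    choose U V hU hV h using hA
    refine mem_SigmaO_two.2 ⟨fun k => U k.unpair.1 k.unpair.2, fun k => V k.unpair.1 k.unpair.2,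
      fun _ => hU _ _, fun _ => hV _ _, ?_⟩
    rw [iUnion_unpair fun i j => U i j \ V i j]
    exact iUnion_congr h
  · simp only [mem_SigmaO_of_two_lt h] at hA
    choose S hS h' using hA
    refine (mem_SigmaO_of_two_lt h).2 ⟨fun k => S k.unpair.1 k.unpair.2, fun _ => hS _ _, ?_⟩
    rw [iUnion_unpair fun i j => (S i j)ᶜ]
    exact iUnion_congr h'

theorem union_mem_SigmaO {γ : Ordinal.{0}} (hγ : 1 ≤ γ) {A B : Set X}
    (hA : A ∈ SigmaO X γ) (hB : B ∈ SigmaO X γ) : A ∪ B ∈ SigmaO X γ := by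
  have h : A ∪ B = ⋃ n : ℕ, if n = 0 then A else B := by
    ext x
    simp only [mem_union, mem_iUnion]
    refine ⟨?_, ?_⟩
    · rintro (hx | hx)
      · exact ⟨0, by simpa using hx⟩
      · exact ⟨1, by simpa using hx⟩
    · rintro ⟨n, hn⟩
      split_ifs at hn
      · exact Or.inl hn
      · exact Or.inr hn
  rw [h]
  refine iUnion_mem_SigmaO hγ fun n => ?_
  split_ifs
  · exact hA
  · exact hB

theorem diff_mem_SigmaO_two {U V : Set X} (hU : IsOpen U) (hV : IsOpen V) :
    U \ V ∈ SigmaO X 2 :=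
  mem_SigmaO_two.2 ⟨fun _ => U, fun _ => V, fun _ => hU, fun _ => hV, (iUnion_const _).symm⟩

theorem mem_SigmaO_two_of_isOpen {U : Set X} (hU : IsOpen U) : U ∈ SigmaO X 2 := by
  simpa using diff_mem_SigmaO_two hU isOpen_empty

theorem compl_diff_mem_SigmaO_two {U V : Set X} (hU : IsOpen U) (hV : IsOpen V) :
    (U \ V)ᶜ ∈ SigmaO X 2 := by
  rw [sdiff_eq, compl_inter, compl_compl, compl_eq_univ_sdiff]
  exact union_mem_SigmaO one_le_two
    (diff_mem_SigmaO_two isOpen_univ hU) (mem_SigmaO_two_of_isOpen hV)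

/-- From level two on, every set of a level is a countable union of complements of sets of levels
not exceeding it. At level two the same level is needed, as open sets need not be `Fσ`. -/
theorem exists_eq_iUnion_compl {γ : Ordinal.{0}} (hγ : 2 ≤ γ) {A : Set X}
    (hA : A ∈ SigmaO X γ) : ∃ S : ℕ → Set X,
      (∀ n, ∃ β ≤ γ, 1 ≤ β ∧ S n ∈ SigmaO X β) ∧ A = ⋃ n, (S n)ᶜ := by
  rcases hγ.eq_or_lt with rfl | h
  · obtain ⟨U, V, hU, hV, rfl⟩ := mem_SigmaO_two.1 hA
    refine ⟨fun n => (U n \ V n)ᶜ, fun n => ⟨2, le_rfl, one_le_two,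
      compl_diff_mem_SigmaO_two (hU n) (hV n)⟩, by simp only [compl_compl]⟩
  · obtain ⟨S, hS, rfl⟩ := (mem_SigmaO_of_two_lt h).1 hA
    refine ⟨S, fun n => ?_, rfl⟩
    obtain ⟨β, hβ, hβ', hn⟩ := hS n
    exact ⟨β, hβ.le, hβ', hn⟩

theorem SigmaO_mono {γ δ : Ordinal.{0}} (hγ : 1 ≤ γ) (hγδ : γ ≤ δ) :
    SigmaO X γ ⊆ SigmaO X δ := by
  intro A hA
  rcases hγδ.eq_or_lt with rfl | hlt
  · exact hA
  rcases eq_one_or_eq_two_or_two_lt (hγ.trans hγδ) with rfl | rfl | hδ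
  · exact absurd hlt hγ.not_gt
  · obtain rfl : γ = 1 := by
      rcases eq_one_or_eq_two_or_two_lt hγ with h | h | h
      · exact h
      · exact absurd h hlt.ne
      · exact absurd h hlt.not_gt
    exact mem_SigmaO_two_of_isOpen (mem_SigmaO_one.1 hA)
  · rw [mem_SigmaO_of_two_lt hδ]
    rcases eq_one_or_eq_two_or_two_lt hγ with rfl | h
    · have hA := mem_SigmaO_one.1 hA
      refine ⟨fun _ => Aᶜ, fun _ => ⟨2, hδ, one_le_two, ?_⟩, ?_⟩
      · rw [compl_eq_univ_sdiff]
        exact diff_mem_SigmaO_two isOpen_univ hA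
      · rw [iUnion_const, compl_compl]
    · have h2 : 2 ≤ γ := h.elim ge_of_eq le_of_lt
      obtain ⟨S, hS, hA'⟩ := exists_eq_iUnion_compl h2 hA
      refine ⟨S, fun n => ?_, hA'⟩
      obtain ⟨β, hβ, hβ', hn⟩ := hS n
      exact ⟨β, hβ.trans_lt hlt, hβ', hn⟩

theorem diff_mem_SigmaO_add_one {γ : Ordinal.{0}} (hγ : 1 ≤ γ) {A B : Set X}
    (hA : A ∈ SigmaO X γ) (hB : B ∈ SigmaO X γ) : A \ B ∈ SigmaO X (γ + 1) := by
  rcases eq_one_or_eq_two_or_two_lt hγ with rfl | h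
  · rw [one_add_one_eq_two]
    exact diff_mem_SigmaO_two (mem_SigmaO_one.1 hA) (mem_SigmaO_one.1 hB)
  · have h2 : 2 ≤ γ := h.elim ge_of_eq le_of_lt
    obtain ⟨S, hS, rfl⟩ := exists_eq_iUnion_compl h2 hA
    have hlt : γ < γ + 1 := lt_add_one γ
    refine (mem_SigmaO_of_two_lt (h2.trans_lt hlt)).2
      ⟨fun n => S n ∪ B, fun n => ⟨γ, hlt, hγ, ?_⟩, ?_⟩
    · obtain ⟨β, hβ, hβ', hn⟩ := hS n
      exact union_mem_SigmaO hγ (SigmaO_mono hβ' hβ hn) hB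
    · simp only [compl_union, ← sdiff_eq, iUnion_sdiff]

/-- Preimages under a `Σ⁰_{1+α}`-measurable function, without countability of the ordinals. -/
theorem preimage_mem_SigmaO {Y : Type} [TopologicalSpace Y] {f : X → Y} {α : Ordinal.{0}}
    (hf : ∀ U : Set Y, IsOpen U → f ⁻¹' U ∈ SigmaO X (1 + α)) (β : Ordinal.{0}) :
    ∀ A ∈ SigmaO Y (1 + β), f ⁻¹' A ∈ SigmaO X (1 + (α + β)) := by
  induction β using WellFoundedLT.induction with
  | ind β ih =>
  intro A hA
  have hle : 1 + β ≤ 1 + (α + β) := by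
    gcongr
    exact le_add_self
  rcases eq_one_or_eq_two_or_two_lt (le_self_add : 1 ≤ 1 + β) with h | h | h
  · obtain rfl : β = 0 := by simpa using h
    rw [h, mem_SigmaO_one] at hA
    simpa using hf A hA
  · obtain rfl : β = 1 := by
      rw [← one_add_one_eq_two] at h
      exact add_left_cancel h
    rw [h, mem_SigmaO_two] at hA
    obtain ⟨U, V, hU, hV, rfl⟩ := hA
    rw [preimage_iUnion, ← add_assoc]
    exact iUnion_mem_SigmaO (le_self_add.trans le_self_add) fun n =>
      diff_mem_SigmaO_add_one le_self_add (hf _ (hU n)) (hf _ (hV n))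
  · obtain ⟨S, hS, rfl⟩ := (mem_SigmaO_of_two_lt h).1 hA
    refine (mem_SigmaO_of_two_lt (h.trans_le hle)).2 ⟨fun n => f ⁻¹' S n, fun n => ?_, ?_⟩
    · obtain ⟨γ, hγ, hγ', hn⟩ := hS n
      obtain ⟨δ, rfl⟩ := exists_add_of_le hγ'
      have hδ : δ < β := lt_of_add_lt_add_left hγ
      exact ⟨1 + (α + δ), by gcongr, le_self_add, ih δ hδ _ hn⟩
    · simp only [preimage_iUnion, preimage_compl]

end Hierarchy

/-- Lemma "measur": a `Σ⁰_{1+α}`-measurable function pulls `Σ⁰_{1+β}` back to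
`Σ⁰_{1+(α+β)}`; in particular, a continuous function pulls each level back to itself. -/
theorem statement7 {X Y : Type} [TopologicalSpace X] [TopologicalSpace Y] (f : X → Y)
    (α : Ordinal.{0}) (hα : α < w1)
    (hf : ∀ U : Set Y, IsOpen U → f ⁻¹' U ∈ SigmaO X (1 + α)) :
    (∀ β < w1, ∀ A ∈ SigmaO Y (1 + β), f ⁻¹' A ∈ SigmaO X (1 + (α + β))) ∧
    (Continuous f → ∀ β < w1, ∀ A ∈ SigmaO Y (1 + β), f ⁻¹' A ∈ SigmaO X (1 + β)) := by
  refine ⟨fun β _ => preimage_mem_SigmaO hf β, fun hc β _ A hA => ?_⟩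
  have h0 : ∀ U : Set Y, IsOpen U → f ⁻¹' U ∈ SigmaO X (1 + 0) := fun U hU => by
    rw [add_zero, mem_SigmaO_one]
    exact hU.preimage hc
  simpa using preimage_mem_SigmaO h0 β A hA

end

end IFHpaper
end

section
/- Let Q be a quasiorder, X a set, 𝓛(X) a base in X, and u a term. Then every u-family in 𝓛(X) determines at most one function A : X → Q, and every reduced u-family in 𝓛(X) determines exactly one function A : X → Q. -/
open Set

namespace IFHpaper

noncomputable section

theorem subset_of_mem_restrictL {X : Type} {L : Ordinal.{0} → Set (Set X)} {D W : Set X}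
    {α : Ordinal.{0}} (h : W ∈ restrictL L D α) : W ⊆ D := by
  obtain ⟨S, -, rfl⟩ := h
  exact inter_subset_left

theorem Determines.eqOn {X Q : Type} {u : Term Q} {L : Ordinal.{0} → Set (Set X)} {D : Set X}
    {F : Fam u L D} {A B : X → Q} (hA : Determines u L D F A) (hB : Determines u L D F B) :
    EqOn A B D := by
  induction F with
  | const q L D =>
    simp only [Determines] at hA hB
    exact fun x hx => (hA x hx).trans (hB x hx).symm
  | s a u L D F ih =>
    simp only [Determines] at hA hB
    exact ih hA hB
  | Fc q us L D U hU fams ih =>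
    simp only [Determines] at hA hB
    intro x hx
    by_cases hxU : x ∈ ⋃ i, U i
    · obtain ⟨i, hi⟩ := mem_iUnion.1 hxU
      exact ih i (hA.2 i) (hB.2 i) hi
    · exact (hA.1 x ⟨hx, hxU⟩).trans (hB.1 x ⟨hx, hxU⟩).symm
  | Fo a us L D U hU F0 fams ih0 ih =>
    simp only [Determines] at hA hB
    intro x hx
    by_cases hxU : x ∈ ⋃ i, U i
    · obtain ⟨i, hi⟩ := mem_iUnion.1 hxU
      exact ih i (hA.2 i) (hB.2 i) hi
    · exact ih0 hA.1 hB.1 ⟨hx, hxU⟩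

theorem Determines.congr {X Q : Type} {u : Term Q} {L : Ordinal.{0} → Set (Set X)} {D : Set X}
    {F : Fam u L D} {A B : X → Q} (hA : Determines u L D F A) (hAB : EqOn A B D) :
    Determines u L D F B := by
  induction F with
  | const q L D =>
    simp only [Determines] at hA ⊢
    exact fun x hx => (hAB hx).symm.trans (hA x hx)
  | s a u L D F ih =>
    simp only [Determines] at hA ⊢
    exact ih hA hAB
  | Fc q us L D U hU fams ih =>
    simp only [Determines] at hA ⊢
    exact ⟨fun x hx => (hAB hx.1).symm.trans (hA.1 x hx),
      fun i => ih i (hA.2 i) (hAB.mono (subset_of_mem_restrictL (hU i)))⟩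
  | Fo a us L D U hU F0 fams ih0 ih =>
    simp only [Determines] at hA ⊢
    exact ⟨ih0 hA.1 (hAB.mono sdiff_subset),
      fun i => ih i (hA.2 i) (hAB.mono (subset_of_mem_restrictL (hU i)))⟩

/-- Functions can be glued along pairwise disjoint sets and the complement of their union. -/
theorem exists_glue {X Q : Type} {U : ℕ → Set X} (hU : ∀ i j, i ≠ j → U i ∩ U j = ∅)
    (A₀ : X → Q) (A : ℕ → X → Q) :
    ∃ B : X → Q, EqOn A₀ B (⋃ i, U i)ᶜ ∧ ∀ i, EqOn (A i) B (U i) := by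
  classical
  refine ⟨fun x => if h : ∃ i, x ∈ U i then A h.choose x else A₀ x, fun x hx => ?_,
    fun i x hx => ?_⟩
  · have h : ¬ ∃ i, x ∈ U i := fun h => hx (mem_iUnion.2 h)
    simp only [dif_neg h]
  · have h : ∃ i, x ∈ U i := ⟨i, hx⟩
    have hi : i = h.choose := by
      by_contra hne
      exact (hU i _ hne).subset ⟨hx, h.choose_spec⟩
    simp only [dif_pos h, ← hi]

theorem FamReduced.exists_determines {X Q : Type} {u : Term Q}
    {L : Ordinal.{0} → Set (Set X)} {D : Set X} {F : Fam u L D} (hF : FamReduced u L D F) :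
    ∃ A : X → Q, Determines u L D F A := by
  induction F with
  | const q L D => exact ⟨fun _ => q, by simp [Determines]⟩
  | s a u L D F ih =>
    simp only [FamReduced] at hF
    simp only [Determines]
    exact ih hF
  | Fc q us L D U hU fams ih =>
    simp only [FamReduced] at hF
    simp only [Determines]
    choose A hA using fun i => ih i (hF.2 i)
    obtain ⟨B, hB₀, hB⟩ := exists_glue hF.1 (fun _ => q) A
    exact ⟨B, fun x hx => (hB₀ hx.2).symm, fun i => (hA i).congr (hB i)⟩
  | Fo a us L D U hU F0 fams ih0 ih =>
    simp only [FamReduced] at hF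
    simp only [Determines]
    obtain ⟨A₀, hA₀⟩ := ih0 hF.2.1
    choose A hA using fun i => ih i (hF.2.2 i)
    obtain ⟨B, hB₀, hB⟩ := exists_glue hF.1 A₀ A
    exact ⟨B, hA₀.congr (hB₀.mono fun _ hx => hx.2), fun i => (hA i).congr (hB i)⟩

/-- Lemma "tfaml": every `u`-family determines at most one `Q`-partition, and every
reduced `u`-family determines exactly one. -/
theorem statement9 {X Q : Type} [Preorder Q] (L : Ordinal.{0} → Set (Set X))
    (hL : IsBase L) (u : Term Q) :
    (∀ F : Fam u L Set.univ, ∀ A B : X → Q,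
      Determines u L Set.univ F A → Determines u L Set.univ F B → A = B) ∧
    (∀ F : Fam u L Set.univ, FamReduced u L Set.univ F →
      ∃! A : X → Q, Determines u L Set.univ F A) := by
  have huniq : ∀ F : Fam u L Set.univ, ∀ A B : X → Q,
      Determines u L Set.univ F A → Determines u L Set.univ F B → A = B :=
    fun F A B hA hB => funext fun x => hA.eqOn hB (mem_univ x)
  refine ⟨huniq, fun F hF => ?_⟩
  obtain ⟨A, hA⟩ := hF.exists_determines
  exact ⟨A, hA, fun B hB => huniq F B A hB hA⟩

end

end IFHpaper
end

section
/- Let Q be a quasiorder and 𝓛(X) a reducible base in a set X, i.e. a base every level 𝓛_α of which has the σ-reduction property. Then 𝓛(X,u) = red-𝓛(X,u) for every term u; that is, every function X → Q determined by some u-family in 𝓛(X) is determined by some reduced u-family in 𝓛(X). -/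
open Set

namespace IFHpaper

noncomputable section

theorem w1_eq_omega_one : w1 = Ordinal.omega 1 :=
  Cardinal.ord_aleph 1

/-- The countable ordinals are closed under `(α, β) ↦ ω ^ α + β`. -/
theorem omega0_opow_add_lt_w1 {α β : Ordinal.{0}} (hα : α < w1) (hβ : β < w1) :
    Ordinal.omega0 ^ α + β < w1 := by
  rw [w1_eq_omega_one] at hα hβ ⊢
  exact Ordinal.isPrincipal_add_omega 1
    (Ordinal.isPrincipal_opow_omega 1 Ordinal.omega0_lt_omega_one hα) hβ

/-- Reducibility of a base is inherited by its `ω ^ a`-shift. -/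
theorem sigmaReduction_shiftL {X : Type} {L : Ordinal.{0} → Set (Set X)}
    (hred : ∀ α < w1, SigmaReduction (L α)) (a : CtbOrd) :
    ∀ α < w1, SigmaReduction (shiftL L (Ordinal.omega0 ^ a.1) α) :=
  fun _ hα => hred _ (omega0_opow_add_lt_w1 a.2 hα)

/-- Sets from `𝓛₀(D)` can be shrunk to pairwise disjoint sets from `𝓛₀(D')`, where `D' ⊆ D`,
whose union is the trace on `D'` of the original union. -/
theorem exists_disjoint_restrictL {X : Type} {L : Ordinal.{0} → Set (Set X)}
    (hred : SigmaReduction (L 0)) {D D' : Set X} (hD : D' ⊆ D) {U : ℕ → Set X}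
    (hU : ∀ i, U i ∈ restrictL L D 0) :
    ∃ V : ℕ → Set X, (∀ i, V i ∈ restrictL L D' 0) ∧ (∀ i, V i ⊆ U i) ∧
      (∀ i j, i ≠ j → V i ∩ V j = ∅) ∧ D' \ ⋃ i, V i ⊆ D \ ⋃ i, U i := by
  choose S hS hUS using hU
  obtain ⟨S', hS', hsub, hdisj, hunion⟩ := hred S hS
  refine ⟨fun i => D' ∩ S' i, fun i => ⟨S' i, hS' i, rfl⟩, fun i => ?_, fun i j hij => ?_, ?_⟩
  · rw [hUS i]
    exact inter_subset_inter hD (hsub i)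
  · rw [← inter_inter_distrib_left, hdisj i j hij, inter_empty]
  · rintro x ⟨hxD, hx⟩
    refine ⟨hD hxD, fun hxU => hx ?_⟩
    rw [← inter_iUnion, hunion]
    obtain ⟨i, hi⟩ := mem_iUnion.mp hxU
    rw [hUS i] at hi
    exact ⟨hxD, mem_iUnion.mpr ⟨i, hi.2⟩⟩

/-- Over a reducible base, a family on `D` determining `A` yields a reduced family determining `A`
on every subset of `D`. -/
theorem exists_famReduced_of_determines {X Q : Type} {u : Term Q}
    {L : Ordinal.{0} → Set (Set X)} {D : Set X} (F : Fam u L D)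
    (hred : ∀ α < w1, SigmaReduction (L α)) {D' : Set X} (hD : D' ⊆ D) {A : X → Q}
    (hA : Determines u L D F A) :
    ∃ F' : Fam u L D', FamReduced u L D' F' ∧ Determines u L D' F' A := by
  have h0 : (0 : Ordinal.{0}) < w1 := w1_eq_omega_one ▸ Ordinal.omega_pos 1
  induction F generalizing D' with
  | const q L D =>
    refine ⟨.const q L D', ?_, ?_⟩
    · simp only [FamReduced]
    · simp only [Determines] at hA ⊢
      exact fun x hx => hA x (hD hx)
  | s a u L D F ih =>
    simp only [Determines] at hA
    obtain ⟨F', hF', hA'⟩ := ih (sigmaReduction_shiftL hred a) hD hA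
    refine ⟨.s a u L D' F', ?_, ?_⟩
    · simpa only [FamReduced] using hF'
    · simpa only [Determines] using hA'
  | Fc q us L D U hU fams ih =>
    simp only [Determines] at hA
    obtain ⟨V, hV, hVU, hdisj, hcomp⟩ := exists_disjoint_restrictL (hred 0 h0) hD hU
    choose F' hF' hA' using fun i => ih i hred (hVU i) (hA.2 i)
    refine ⟨.Fc q us L D' V hV F', ?_, ?_⟩
    · simp only [FamReduced]
      exact ⟨hdisj, hF'⟩
    · simp only [Determines]
      exact ⟨fun x hx => hA.1 x (hcomp hx), hA'⟩
  | Fo a us L D U hU F0 fams ih0 ih =>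
    simp only [Determines] at hA
    obtain ⟨V, hV, hVU, hdisj, hcomp⟩ := exists_disjoint_restrictL (hred 0 h0) hD hU
    obtain ⟨F0', hF0', hA0'⟩ := ih0 (sigmaReduction_shiftL hred a) hcomp hA.1
    choose F' hF' hA' using fun i => ih i hred (hVU i) (hA.2 i)
    refine ⟨.Fo a us L D' V hV F0' F', ?_, ?_⟩
    · simp only [FamReduced]
      exact ⟨hdisj, hF0', hF'⟩
    · simp only [Determines]
      exact ⟨hA0', hA'⟩

/-- Proposition "red-hier": over a reducible base, every level of the `Q`-IFH equals its
reduced version. -/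
theorem statement13 {X Q : Type} [Preorder Q] (L : Ordinal.{0} → Set (Set X))
    (hL : IsBase L) (hred : ∀ α < w1, SigmaReduction (L α)) (u : Term Q) :
    level Q L u = levelRed Q L u := by
  refine Set.Subset.antisymm ?_ ?_
  · rintro A ⟨F, hA⟩
    exact exists_famReduced_of_determines F hred subset_rfl hA
  · rintro A ⟨F, -, hA⟩
    exact ⟨F, hA⟩

end

end IFHpaper
end
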